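/- Let r ≥ 1 be an integer and, for j = 1,…,r, let n_j ≥ 1 be integers, m_j > 0 reals, and let (μ^j_k)_{k∈ℕ} be sequences having Weyl counting data (n_j, m_j) with μ^j_k > 1 for all k. Set p = max_{1≤j≤r} n_j/m_j and s = #{j : n_j/m_j = p}. Then for every real c < p, F(τ, c) = Σ_{(k₁,…,k_r)∈ℕ^r : μ¹_{k₁}···μ^r_{k_r} < τ} (μ¹_{k₁}···μ^r_{k_r})^{−c} satisfies F(τ, c) = O(τ^{p−c}·(log τ)^{s−1}) as τ → +∞. -/

import Mathlib

open Filter Topology Asymptotics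

/-- A sequence `μ` has Weyl counting data `(n, m)` if `μ k ≥ 1` for every `k` and there is
`K > 0` such that for every `λ ≥ 1` the set of indices `k` with `λ ≤ μ k ^ (1/m) ≤ λ + 1`
is finite, with at most `K * λ ^ (n - 1)` elements. -/
def WeylData (n : ℕ) (m : ℝ) (μ : ℕ → ℝ) : Prop :=
  (∀ k, 1 ≤ μ k) ∧
  ∃ K : ℝ, 0 < K ∧ ∀ lam : ℝ, 1 ≤ lam →
    {k : ℕ | lam ≤ μ k ^ (1 / m) ∧ μ k ^ (1 / m) ≤ lam + 1}.Finite ∧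
    (Nat.card {k : ℕ | lam ≤ μ k ^ (1 / m) ∧ μ k ^ (1 / m) ≤ lam + 1} : ℝ) ≤
      K * lam ^ ((n : ℝ) - 1)

lemma weyl_count {n : ℕ} {m : ℝ} {μ : ℕ → ℝ} (hn : 1 ≤ n) (hm : 0 < m)
    (h : WeylData n m μ) :
    ∃ C : ℝ, 0 < C ∧ ∀ T : ℝ, 1 ≤ T → {k | μ k ≤ T}.Finite ∧
      ∀ A : Finset ℕ, (∀ k ∈ A, μ k ≤ T) → (A.card : ℝ) ≤ C * T ^ ((n : ℝ) / m) := by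
  obtain ⟨h1, K, hK, hb⟩ := h
  refine ⟨K, hK, fun T hT => ?_⟩
  have hn' : (0 : ℝ) ≤ (n : ℝ) - 1 := by
    have : (1 : ℝ) ≤ n := by exact_mod_cast hn
    linarith
  have hx1 : 1 ≤ T ^ (1 / m) := Real.one_le_rpow hT (by positivity)
  set x := T ^ (1 / m) with hx
  have key : ∀ k, μ k ≤ T → ∃ i ∈ Finset.Icc 1 ⌊x⌋₊,
      (i : ℝ) ≤ μ k ^ (1 / m) ∧ μ k ^ (1 / m) ≤ (i : ℝ) + 1 := by
    intro k hk
    have h0 : 1 ≤ μ k ^ (1 / m) := Real.one_le_rpow (h1 k) (by positivity)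
    have h2 : μ k ^ (1 / m) ≤ x :=
      Real.rpow_le_rpow (by linarith [h1 k]) hk (by positivity)
    refine ⟨⌊μ k ^ (1 / m)⌋₊, Finset.mem_Icc.2 ⟨Nat.le_floor (by simpa using h0),
      Nat.floor_le_floor h2⟩, Nat.floor_le (by linarith), (Nat.lt_floor_add_one _).le⟩
  have hfin : ∀ i ∈ Finset.Icc 1 ⌊x⌋₊,
      {k : ℕ | (i : ℝ) ≤ μ k ^ (1 / m) ∧ μ k ^ (1 / m) ≤ (i : ℝ) + 1}.Finite := by
    intro i hi
    exact (hb i (by exact_mod_cast (Finset.mem_Icc.1 hi).1)).1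
  refine ⟨?_, ?_⟩
  · refine ((Finset.Icc 1 ⌊x⌋₊).finite_toSet.biUnion hfin).subset ?_
    intro k hk
    obtain ⟨i, hi, h⟩ := key k hk
    exact Set.mem_biUnion (show i ∈ (↑(Finset.Icc 1 ⌊x⌋₊) : Set ℕ) from hi) h
  · intro A hA
    classical
    have hsub : A ⊆ (Finset.Icc 1 ⌊x⌋₊).biUnion
        (fun i => A.filter (fun k => (i : ℝ) ≤ μ k ^ (1 / m) ∧ μ k ^ (1 / m) ≤ (i : ℝ) + 1)) := by
      intro k hk
      obtain ⟨i, hi, h⟩ := key k (hA k hk)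
      exact Finset.mem_biUnion.2 ⟨i, hi, Finset.mem_filter.2 ⟨hk, h⟩⟩
    have hc1 : (A.card : ℝ) ≤ ∑ i ∈ Finset.Icc 1 ⌊x⌋₊,
        ((A.filter (fun k => (i : ℝ) ≤ μ k ^ (1 / m) ∧
          μ k ^ (1 / m) ≤ (i : ℝ) + 1)).card : ℝ) := by
      exact_mod_cast (Finset.card_le_card hsub).trans Finset.card_biUnion_le
    have hc2 : ∀ i ∈ Finset.Icc 1 ⌊x⌋₊, ((A.filter (fun k => (i : ℝ) ≤ μ k ^ (1 / m) ∧
          μ k ^ (1 / m) ≤ (i : ℝ) + 1)).card : ℝ) ≤ K * x ^ ((n : ℝ) - 1) := by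
      intro i hi
      have hi' := Finset.mem_Icc.1 hi
      have hi1 : (1 : ℝ) ≤ i := by exact_mod_cast hi'.1
      have hix : (i : ℝ) ≤ x := (Nat.le_floor_iff (by linarith)).1 hi'.2
      have h3 := (hb i hi1).2
      have h4 : (A.filter (fun k => (i : ℝ) ≤ μ k ^ (1 / m) ∧
          μ k ^ (1 / m) ≤ (i : ℝ) + 1)).card ≤
          Nat.card {k : ℕ | (i : ℝ) ≤ μ k ^ (1 / m) ∧ μ k ^ (1 / m) ≤ (i : ℝ) + 1} := by
        rw [Nat.card_coe_set_eq, ← Set.ncard_coe_finset]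
        refine Set.ncard_le_ncard ?_ (hfin i hi)
        intro k hk
        exact (Finset.mem_filter.1 hk).2
      have h5 : (i : ℝ) ^ ((n : ℝ) - 1) ≤ x ^ ((n : ℝ) - 1) :=
        Real.rpow_le_rpow (by linarith) hix hn'
      calc _ ≤ _ := (by exact_mod_cast h4 : _ ≤ ((Nat.card {k : ℕ | (i : ℝ) ≤ μ k ^ (1 / m) ∧ μ k ^ (1 / m) ≤ (i : ℝ) + 1} : ℕ) : ℝ))
        _ ≤ _ := h3
        _ ≤ _ := by gcongr
    have hc3 := hc1.trans (Finset.sum_le_sum hc2)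
    rw [Finset.sum_const, Nat.card_Icc, nsmul_eq_mul, Nat.add_sub_cancel] at hc3
    have hx0 : 0 < x := by linarith
    have h6 : x * x ^ ((n : ℝ) - 1) = T ^ ((n : ℝ) / m) := by
      have : x * x ^ ((n : ℝ) - 1) = x ^ (n : ℝ) := by
        rw [Real.rpow_sub_one hx0.ne']; field_simp
      rw [this, hx, ← Real.rpow_mul (by linarith)]
      congr 1; field_simp
    calc (A.card : ℝ) ≤ _ := hc3
      _ ≤ x * (K * x ^ ((n : ℝ) - 1)) := by
        gcongr
        exact Nat.floor_le hx0.le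
      _ = K * T ^ ((n : ℝ) / m) := by rw [← h6]; ring

lemma weyl_sum {a : ℝ} {μ : ℕ → ℝ} {C : ℝ} (h1 : ∀ k, 1 ≤ μ k)
    (hC : 0 < C) (hb : ∀ T : ℝ, 1 ≤ T →
      ∀ A : Finset ℕ, (∀ k ∈ A, μ k ≤ T) → (A.card : ℝ) ≤ C * T ^ a) (b : ℝ) :
    ∃ D : ℝ, 0 < D ∧ ∀ T : ℝ, 1 ≤ T → ∀ A : Finset ℕ, (∀ k ∈ A, μ k ≤ T) →
      ∑ k ∈ A, μ k ^ (-b) ≤ D * ∑ l ∈ Finset.range (⌊Real.log T⌋₊ + 1), Real.exp (a - b) ^ l := by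
  refine ⟨Real.exp |b| * C * Real.exp a, by positivity, fun T hT A hA => ?_⟩
  classical
  have hmaps : ∀ k ∈ A, ⌊Real.log (μ k)⌋₊ ∈ Finset.range (⌊Real.log T⌋₊ + 1) := by
    intro k hk
    rw [Finset.mem_range, Nat.lt_succ_iff]
    exact Nat.floor_le_floor (Real.log_le_log (by linarith [h1 k]) (hA k hk))
  rw [← Finset.sum_fiberwise_of_maps_to hmaps, Finset.mul_sum]
  refine Finset.sum_le_sum fun l _ => ?_
  have hlev : ∀ k, ⌊Real.log (μ k)⌋₊ = l →
      (l : ℝ) ≤ Real.log (μ k) ∧ Real.log (μ k) ≤ l + 1 := by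
    intro k hk
    have h0 := Real.log_nonneg (h1 k)
    rw [← hk]
    exact ⟨Nat.floor_le h0, (Nat.lt_floor_add_one _).le⟩
  have hcard := hb (Real.exp (l + 1)) (Real.one_le_exp (by positivity))
    (A.filter (fun k => ⌊Real.log (μ k)⌋₊ = l)) (by
      intro k hk
      have := (hlev k (Finset.mem_filter.1 hk).2).2
      exact (Real.log_le_iff_le_exp (by linarith [h1 k])).1 this)
  have hterm : ∀ k ∈ A.filter (fun k => ⌊Real.log (μ k)⌋₊ = l),
      μ k ^ (-b) ≤ Real.exp |b| * Real.exp (-b * l) := by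
    intro k hk
    obtain ⟨h2, h3⟩ := hlev k (Finset.mem_filter.1 hk).2
    rw [Real.rpow_def_of_pos (by linarith [h1 k]), ← Real.exp_add]
    apply Real.exp_le_exp.2
    have : -b * (Real.log (μ k) - l) ≤ |b| * 1 := by
      apply mul_le_mul (neg_le_abs b) (by linarith) (by linarith) (abs_nonneg b)
    linarith
  calc _ ≤ _ := Finset.sum_le_sum hterm
    _ = ((A.filter (fun k => ⌊Real.log (μ k)⌋₊ = l)).card : ℝ) *
        (Real.exp |b| * Real.exp (-b * l)) := by rw [Finset.sum_const, nsmul_eq_mul]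
    _ ≤ (C * Real.exp (l + 1) ^ a) * (Real.exp |b| * Real.exp (-b * l)) := by gcongr
    _ = _ := by
      rw [← Real.exp_mul, ← Real.exp_nat_mul]
      have : Real.exp ((l + 1) * a) * Real.exp (-b * l) =
        Real.exp a * Real.exp (l * (a - b)) := by
        rw [← Real.exp_add, ← Real.exp_add]; ring_nf
      linear_combination (C * Real.exp |b|) * this

lemma weyl_sum_gt {a : ℝ} {μ : ℕ → ℝ} {C : ℝ} (h1 : ∀ k, 1 ≤ μ k)
    (hC : 0 < C) (hb : ∀ T : ℝ, 1 ≤ T →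
      ∀ A : Finset ℕ, (∀ k ∈ A, μ k ≤ T) → (A.card : ℝ) ≤ C * T ^ a) {b : ℝ} (hab : b < a) :
    ∃ D : ℝ, 0 < D ∧ ∀ T : ℝ, 1 ≤ T → ∀ A : Finset ℕ, (∀ k ∈ A, μ k ≤ T) →
      ∑ k ∈ A, μ k ^ (-b) ≤ D * T ^ (a - b) := by
  obtain ⟨D, hD, h⟩ := weyl_sum h1 hC hb b
  have hq : 1 < Real.exp (a - b) := Real.one_lt_exp_iff.2 (by linarith)
  set q := Real.exp (a - b) with hqdef
  have hq' : 0 < q - 1 := by linarith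
  refine ⟨D * (q / (q - 1)), by positivity, fun T hT A hA => (h T hT A hA).trans ?_⟩
  rw [mul_assoc]
  refine mul_le_mul_of_nonneg_left ?_ hD.le
  rw [geom_sum_eq hq.ne']
  have : q ^ ⌊Real.log T⌋₊ ≤ T ^ (a - b) := by
    rw [Real.rpow_def_of_pos (by linarith), hqdef, ← Real.exp_nat_mul]
    apply Real.exp_le_exp.2
    exact mul_le_mul_of_nonneg_right (Nat.floor_le (Real.log_nonneg hT)) (by linarith)
  rw [div_mul_eq_mul_div]
  gcongr
  rw [pow_succ]
  nlinarith

lemma weyl_sum_le {a : ℝ} {μ : ℕ → ℝ} {C : ℝ} (h1 : ∀ k, 1 ≤ μ k)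
    (hC : 0 < C) (hb : ∀ T : ℝ, 1 ≤ T →
      ∀ A : Finset ℕ, (∀ k ∈ A, μ k ≤ T) → (A.card : ℝ) ≤ C * T ^ a) {b : ℝ} (hab : a ≤ b) :
    ∃ D : ℝ, 0 < D ∧ ∀ T : ℝ, 1 ≤ T → ∀ A : Finset ℕ, (∀ k ∈ A, μ k ≤ T) →
      ∑ k ∈ A, μ k ^ (-b) ≤ D * (if a = b then 1 + Real.log T else 1) := by
  obtain ⟨D, hD, h⟩ := weyl_sum h1 hC hb b
  rcases hab.eq_or_lt with hab | hab
  · refine ⟨D, hD, fun T hT A hA => (h T hT A hA).trans ?_⟩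
    refine mul_le_mul_of_nonneg_left ?_ hD.le
    have := Nat.floor_le (Real.log_nonneg hT)
    simp only [hab, sub_self, Real.exp_zero, one_pow, Finset.sum_const, Finset.card_range,
      nsmul_eq_mul, mul_one, if_true]
    push_cast; linarith
  · have hq : Real.exp (a - b) < 1 := Real.exp_lt_one_iff.2 (by linarith)
    have hq0 := Real.exp_pos (a - b)
    set q := Real.exp (a - b) with hqdef
    have hq' : 0 < 1 - q := by linarith
    refine ⟨D * (1 / (1 - q)), by positivity, fun T hT A hA => (h T hT A hA).trans ?_⟩
    rw [if_neg hab.ne, mul_one]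
    refine mul_le_mul_of_nonneg_left ?_ hD.le
    rw [one_div, ← tsum_geometric_of_lt_one hq0.le hq]
    exact (summable_geometric_of_lt_one hq0.le hq).sum_le_tsum _ (fun i _ => by positivity)

lemma one_le_prod_aux {r : ℕ} (g : Fin r → ℝ) (h : ∀ i, 1 ≤ g i) : 1 ≤ ∏ i, g i := by
  calc (1 : ℝ) = ∏ _i : Fin r, (1 : ℝ) := by simp
    _ ≤ _ := Finset.prod_le_prod (fun _ _ => zero_le_one) (fun i _ => h i)

theorem multi_factor_sum_subcritical (r : ℕ) (hr : 1 ≤ r)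
    (n : Fin r → ℕ) (m : Fin r → ℝ) (μ : Fin r → ℕ → ℝ)
    (hn : ∀ j, 1 ≤ n j) (hm : ∀ j, 0 < m j)
    (hμ : ∀ j, WeylData (n j) (m j) (μ j)) (hμ1 : ∀ j k, 1 < μ j k)
    (p : ℝ) (s : ℕ)
    (hple : ∀ j, (n j : ℝ) / m j ≤ p) (hpmem : ∃ j, (n j : ℝ) / m j = p)
    (hs : s = Nat.card {j : Fin r | (n j : ℝ) / m j = p})
    (c : ℝ) (hc : c < p) :
    (fun τ : ℝ => ∑' t : {t : Fin r → ℕ | (∏ j, μ j (t j)) < τ},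
        (∏ j, μ j (t.1 j)) ^ (-c)) =O[atTop]
      (fun τ : ℝ => τ ^ (p - c) * Real.log τ ^ (s - 1)) := by
  classical
  obtain ⟨r, rfl⟩ : ∃ q, r = q + 1 := ⟨r - 1, by omega⟩
  obtain ⟨j0, hj0⟩ := hpmem
  have h1 : ∀ j k, 1 ≤ μ j k := fun j k => (hμ1 j k).le
  choose C hC hb using fun j => weyl_count (hn j) (hm j) (hμ j)
  obtain ⟨D0, hD0, hS0⟩ := weyl_sum_gt (h1 j0) (hC j0) (fun T hT => (hb j0 T hT).2)
    (b := c) (by rw [hj0]; exact hc)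
  choose D hD hS using fun j => weyl_sum_le (h1 j) (hC j) (fun T hT => (hb j T hT).2) (hple j)
  rw [hj0] at hS0
  -- the number of the other critical indices
  have hcount : ∀ L : ℝ, ∏ i : Fin r,
      (if (n (j0.succAbove i) : ℝ) / m (j0.succAbove i) = p then L else 1) = L ^ (s - 1) := by
    intro L
    have e1 : s = ∑ j : Fin (r + 1), (if (n j : ℝ) / m j = p then 1 else 0) := by
      rw [hs, Finset.sum_boole, Nat.card_coe_set_eq, ← Set.ncard_coe_finset]
      simp
    rw [Fin.sum_univ_succAbove _ j0, if_pos hj0] at e1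
    have e2 : s - 1 = ∑ i : Fin r,
        (if (n (j0.succAbove i) : ℝ) / m (j0.succAbove i) = p then 1 else 0) := by omega
    rw [e2, ← Finset.prod_pow_eq_pow_sum]
    refine Finset.prod_congr rfl fun i _ => ?_
    split_ifs <;> simp
  refine IsBigO.of_bound (D0 * (∏ i : Fin r, D (j0.succAbove i)) * 2 ^ (s - 1)) ?_
  filter_upwards [eventually_ge_atTop (Real.exp 1)] with τ hτ
  have hlog : 1 ≤ Real.log τ := by
    rw [← Real.log_exp 1]; exact Real.log_le_log (Real.exp_pos 1) hτ
  have hτ1 : 1 ≤ τ := le_trans (Real.one_le_exp (by norm_num)) hτ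
  have hτ0 : 0 < τ := by linarith
  let A : Fin (r + 1) → Finset ℕ := fun j => (hb j τ hτ1).1.toFinset
  have hA : ∀ j k, k ∈ A j ↔ μ j k ≤ τ := fun j k => by simp [A]
  have hP1 : ∀ u : Fin r → ℕ, 1 ≤ ∏ i, μ (j0.succAbove i) (u i) := fun u =>
    one_le_prod_aux _ fun i => h1 _ _
  let U : Finset (Fin r → ℕ) := Fintype.piFinset fun i => A (j0.succAbove i)
  let f : (Fin (r + 1) → ℕ) → ℝ := Set.indicator {t | (∏ j, μ j (t j)) < τ}
    (fun t => (∏ j, μ j (t j)) ^ (-c))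
  have hpos : ∀ t : Fin (r + 1) → ℕ, 0 < ∏ j, μ j (t j) := fun t =>
    Finset.prod_pos fun i _ => by linarith [hμ1 i (t i)]
  have hle : ∀ (t : Fin (r + 1) → ℕ) j, μ j (t j) ≤ ∏ j, μ j (t j) := by
    intro t j
    rw [Fin.prod_univ_succAbove _ j]
    have : 1 ≤ ∏ i, μ (j.succAbove i) (t (j.succAbove i)) :=
      one_le_prod_aux _ fun i => h1 _ _
    nlinarith [hμ1 j (t j)]
  have hsum : (∑' t : {t : Fin (r + 1) → ℕ | (∏ j, μ j (t j)) < τ},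
        (∏ j, μ j (t.1 j)) ^ (-c)) =
      ∑ u ∈ U, ∑ k ∈ A j0, f (j0.insertNth k u) := by
    rw [tsum_subtype {t : Fin (r + 1) → ℕ | (∏ j, μ j (t j)) < τ}
      (fun t => (∏ j, μ j (t j)) ^ (-c))]
    rw [← (Fin.insertNthEquiv (fun _ => ℕ) j0).tsum_eq]
    rw [tsum_eq_sum (s := A j0 ×ˢ U), Finset.sum_product_right]
    · rfl
    · rintro ⟨k, u⟩ hku
      apply Set.indicator_of_notMem
      intro hmem
      apply hku
      have hmem' : ∏ j, μ j ((j0.insertNth k u : Fin (r + 1) → ℕ) j) < τ := hmem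
      rw [Finset.mem_product]
      constructor
      · rw [hA]
        have := hle (j0.insertNth k u) j0
        simp only [Fin.insertNth_apply_same] at this
        exact this.trans hmem'.le
      · rw [Fintype.mem_piFinset]
        intro i
        rw [hA]
        have := hle (j0.insertNth k u) (j0.succAbove i)
        simp only [Fin.insertNth_apply_succAbove] at this
        exact this.trans hmem'.le
  have hinner : ∀ u ∈ U, ∑ k ∈ A j0, f (j0.insertNth k u) ≤
      D0 * τ ^ (p - c) * ∏ i, μ (j0.succAbove i) (u i) ^ (-p) := by
    intro u _
    rw [Real.finsetProd_rpow _ _ (fun i _ => by linarith [h1 (j0.succAbove i) (u i)])]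
    have hP := hP1 u
    set P := ∏ i, μ (j0.succAbove i) (u i) with hPdef
    have hP0 : 0 < P := by linarith
    have hf : ∀ k, f (j0.insertNth k u) =
        if μ j0 k * P < τ then P ^ (-c) * μ j0 k ^ (-c) else 0 := by
      intro k
      have : ∏ j, μ j ((j0.insertNth k u : Fin (r + 1) → ℕ) j) = μ j0 k * P := by
        rw [Fin.prod_univ_succAbove _ j0]; simp [hPdef]
      simp only [f, Set.indicator_apply, Set.mem_ofPred_eq, this]
      rw [Real.mul_rpow (by linarith [h1 j0 k]) hP0.le, mul_comm (P ^ (-c))]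
    simp only [hf]
    rw [← Finset.sum_filter, ← Finset.mul_sum]
    rcases le_or_gt P τ with hPτ | hPτ
    · have hT : 1 ≤ τ / P := (one_le_div hP0).2 hPτ
      have := hS0 (τ / P) hT ((A j0).filter (fun k => μ j0 k * P < τ)) (by
        intro k hk
        rw [le_div_iff₀ hP0]
        exact (Finset.mem_filter.1 hk).2.le)
      calc _ ≤ P ^ (-c) * (D0 * (τ / P) ^ (p - c)) := by gcongr
        _ = _ := by
          rw [Real.div_rpow hτ0.le hP0.le]
          have : P ^ (-c) = P ^ (-p) * P ^ (p - c) := by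
            rw [← Real.rpow_add hP0]; ring_nf
          rw [this]
          have := (Real.rpow_pos_of_pos hP0 (p - c)).ne'
          field_simp
    · rw [Finset.filter_false_of_mem]
      · simp; positivity
      · intro k _
        nlinarith [h1 j0 k]
  have hnn : 0 ≤ ∑ u ∈ U, ∑ k ∈ A j0, f (j0.insertNth k u) :=
    Finset.sum_nonneg fun u _ => Finset.sum_nonneg fun k _ =>
      Set.indicator_nonneg (fun t _ => Real.rpow_nonneg (hpos t).le _) _
  have hprod : ∑ u ∈ U, ∏ i, μ (j0.succAbove i) (u i) ^ (-p) ≤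
      (∏ i : Fin r, D (j0.succAbove i)) * (1 + Real.log τ) ^ (s - 1) := by
    rw [← Finset.prod_univ_sum (fun i => A (j0.succAbove i))
      (fun i k => μ (j0.succAbove i) k ^ (-p)), ← hcount, ← Finset.prod_mul_distrib]
    refine Finset.prod_le_prod (fun i _ => Finset.sum_nonneg fun k _ =>
      Real.rpow_nonneg (by linarith [h1 (j0.succAbove i) k]) _) fun i _ => ?_
    exact hS _ τ hτ1 _ (fun k hk => (hA _ _).1 hk)
  have hDp : 0 < ∏ i : Fin r, D (j0.succAbove i) := Finset.prod_pos fun i _ => hD _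
  have hl0 : 0 ≤ Real.log τ := by linarith
  rw [hsum, Real.norm_of_nonneg hnn, Real.norm_of_nonneg (by positivity)]
  calc _ ≤ _ := Finset.sum_le_sum hinner
    _ = D0 * τ ^ (p - c) * ∑ u ∈ U, ∏ i, μ (j0.succAbove i) (u i) ^ (-p) := by
      rw [Finset.mul_sum]
    _ ≤ D0 * τ ^ (p - c) * ((∏ i : Fin r, D (j0.succAbove i)) * (2 * Real.log τ) ^ (s - 1)) := by
      refine mul_le_mul_of_nonneg_left (hprod.trans ?_) (by positivity)
      refine mul_le_mul_of_nonneg_left ?_ hDp.le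
      exact pow_le_pow_left₀ (by linarith) (by linarith) _
    _ = _ := by rw [mul_pow]; ring
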